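/- arXiv:2410.13189 — 5 statements merged into one kernel-verified Lean document; each statement's English description precedes it below -/
import Mathlib

section
/- Let n, d ≥ 1 and let 𝐌 be an nd × nd complex matrix written in block form 𝐌 = (M_{i,j})_{0 ≤ i,j ≤ n−1} with each block M_{i,j} ∈ ℂ^{d×d}. Then the spectral norm of 𝐌 satisfies ‖𝐌‖ ≤ √( (max_{0≤j≤n−1} Σ_{k=0}^{n−1} ‖M_{k,j}‖) · (max_{0≤i≤n−1} Σ_{k=0}^{n−1} ‖M_{i,k}‖) ); that is, ‖𝐌‖ is at most the geometric mean of the maximal block-column sum and the maximal block-row sum of the spectral norms of its blocks. -/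
/-- The spectral norm (operator norm induced by the Euclidean vector norm)
of a square complex matrix. -/
noncomputable def specNorm {m : Type*} [Fintype m] [DecidableEq m] (A : Matrix m m ℂ) : ℝ :=
  ‖Matrix.toEuclideanCLM (𝕜 := ℂ) A‖

/-- The `nd × nd` block matrix built from an `n × n` array of `d × d` blocks. -/
def blockMat {n d : ℕ} (M : Fin n → Fin n → Matrix (Fin d) (Fin d) ℂ) :
    Matrix (Fin n × Fin d) (Fin n × Fin d) ℂ :=
  Matrix.of fun p q => M p.1 q.1 p.2 q.2

/-- **Schur test** for a nonnegative real matrix with row sums at most `R` and column sums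
at most `C`. -/
theorem sum_sq_sum_mul_le {ι κ : Type*} [Fintype ι] [Fintype κ] {a : ι → κ → ℝ}
    (ha : ∀ i j, 0 ≤ a i j) {C R : ℝ} (hR : 0 ≤ R) (hC : ∀ j, ∑ i, a i j ≤ C)
    (hrow : ∀ i, ∑ j, a i j ≤ R) (t : κ → ℝ) :
    ∑ i, (∑ j, a i j * t j) ^ 2 ≤ C * R * ∑ j, t j ^ 2 :=
  calc
    ∑ i, (∑ j, a i j * t j) ^ 2 ≤ ∑ i, (∑ j, a i j) * ∑ j, a i j * t j ^ 2 :=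
      Finset.sum_le_sum fun i _ =>
        Finset.sum_sq_le_sum_mul_sum_of_sq_le_mul _ (fun j _ => ha i j)
          (fun j _ => mul_nonneg (ha i j) (sq_nonneg _)) fun j _ => le_of_eq (by ring)
    _ ≤ ∑ i, R * ∑ j, a i j * t j ^ 2 :=
      Finset.sum_le_sum fun i _ => mul_le_mul_of_nonneg_right (hrow i)
        (Finset.sum_nonneg fun j _ => mul_nonneg (ha i j) (sq_nonneg _))
    _ = R * ∑ j, (∑ i, a i j) * t j ^ 2 := by
      rw [← Finset.mul_sum, Finset.sum_comm]
      simp only [Finset.sum_mul]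
    _ ≤ R * ∑ j, C * t j ^ 2 :=
      mul_le_mul_of_nonneg_left
        (Finset.sum_le_sum fun j _ => mul_le_mul_of_nonneg_right (hC j) (sq_nonneg _)) hR
    _ = C * R * ∑ j, t j ^ 2 := by
      rw [← Finset.mul_sum]
      ring

theorem specNorm_nonneg {m : Type*} [Fintype m] [DecidableEq m] (A : Matrix m m ℂ) :
    0 ≤ specNorm A :=
  norm_nonneg _

/-- The `i`-th block of a vector indexed by a product. -/
def vecBlock {ι κ : Type*} (x : EuclideanSpace ℂ (ι × κ)) (i : ι) : EuclideanSpace ℂ κ :=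
  WithLp.toLp 2 fun a => x (i, a)

theorem norm_sq_eq_sum_norm_sq_vecBlock {ι κ : Type*} [Fintype ι] [Fintype κ]
    (x : EuclideanSpace ℂ (ι × κ)) : ‖x‖ ^ 2 = ∑ i, ‖vecBlock x i‖ ^ 2 := by
  simp only [EuclideanSpace.norm_sq_eq, Fintype.sum_prod_type, vecBlock]

theorem vecBlock_blockMat {n d : ℕ} (M : Fin n → Fin n → Matrix (Fin d) (Fin d) ℂ)
    (x : EuclideanSpace ℂ (Fin n × Fin d)) (i : Fin n) :
    vecBlock (Matrix.toEuclideanCLM (𝕜 := ℂ) (blockMat M) x) i =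
      ∑ j, Matrix.toEuclideanCLM (𝕜 := ℂ) (M i j) (vecBlock x j) := by
  ext a
  simp [vecBlock, blockMat, Matrix.ofLp_toEuclideanCLM, Matrix.mulVec, dotProduct,
    Fintype.sum_prod_type]

theorem norm_vecBlock_blockMat_le {n d : ℕ} (M : Fin n → Fin n → Matrix (Fin d) (Fin d) ℂ)
    (x : EuclideanSpace ℂ (Fin n × Fin d)) (i : Fin n) :
    ‖vecBlock (Matrix.toEuclideanCLM (𝕜 := ℂ) (blockMat M) x) i‖ ≤
      ∑ j, specNorm (M i j) * ‖vecBlock x j‖ := by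
  rw [vecBlock_blockMat]
  exact norm_sum_le_of_le _ fun j _ => ContinuousLinearMap.le_opNorm _ _

/-- **Spectral norm bound for block matrices.**
The spectral norm of a block matrix is at most the geometric mean of the maximal block-column
sum and the maximal block-row sum of the spectral norms of its blocks. -/
theorem blockMat_specNorm_le (n d : ℕ) (hn : 1 ≤ n) (hd : 1 ≤ d)
    (M : Fin n → Fin n → Matrix (Fin d) (Fin d) ℂ) :
    specNorm (blockMat M) ≤
      Real.sqrt
        ((Finset.univ.sup' (Finset.univ_nonempty_iff.mpr (Fin.pos_iff_nonempty.mp hn))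
            fun j => ∑ k : Fin n, specNorm (M k j)) *
          (Finset.univ.sup' (Finset.univ_nonempty_iff.mpr (Fin.pos_iff_nonempty.mp hn))
            fun i => ∑ k : Fin n, specNorm (M i k))) := by
  generalize hReq : Finset.univ.sup' _ (fun i => ∑ k, specNorm (M i k)) = R
  generalize hCeq : Finset.univ.sup' _ (fun j => ∑ k, specNorm (M k j)) = C
  have hrow (i : Fin n) : ∑ k, specNorm (M i k) ≤ R :=
    hReq ▸ Finset.le_sup' (fun i => ∑ k, specNorm (M i k)) (Finset.mem_univ i)
  have hcol (j : Fin n) : ∑ k, specNorm (M k j) ≤ C :=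
    hCeq ▸ Finset.le_sup' (fun j => ∑ k, specNorm (M k j)) (Finset.mem_univ j)
  have hR : 0 ≤ R := (Finset.sum_nonneg fun k _ => specNorm_nonneg _).trans (hrow ⟨0, hn⟩)
  have hC : 0 ≤ C := (Finset.sum_nonneg fun k _ => specNorm_nonneg _).trans (hcol ⟨0, hn⟩)
  refine ContinuousLinearMap.opNorm_le_bound _ (Real.sqrt_nonneg _) fun x => ?_
  refine (sq_le_sq₀ (norm_nonneg _) (by positivity)).mp ?_
  rw [mul_pow, Real.sq_sqrt (mul_nonneg hC hR), norm_sq_eq_sum_norm_sq_vecBlock,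
    norm_sq_eq_sum_norm_sq_vecBlock x]
  calc
    _ ≤ ∑ i, (∑ j, specNorm (M i j) * ‖vecBlock x j‖) ^ 2 :=
      Finset.sum_le_sum fun i _ =>
        pow_le_pow_left₀ (norm_nonneg _) (norm_vecBlock_blockMat_le M x i) 2
    _ ≤ C * R * ∑ j, ‖vecBlock x j‖ ^ 2 :=
      sum_sq_sum_mul_le (fun i j => specNorm_nonneg (M i j)) hR hcol hrow _
end

section
/- Let M ≥ 1 and M_p ≥ 1 be integers, n = M + M_p, T > 0, η > 0, and h = T/M with ηh ≤ 1. Let L_0, …, L_{M−1} ∈ ℂ^{d×d} be invertible and R_0, …, R_{M−1} ∈ ℂ^{d×d} satisfy ‖L_j^{−1}R_j‖ ≤ e^{−ηh/2} for all 0 ≤ j ≤ M−1. Extend the notation by setting L_{−1} = I, L_j = I for M ≤ j ≤ n−2, and R_j = I for M ≤ j ≤ n−2, and let 𝐀_{M,M_p−1} be the nd × nd block matrix with diagonal blocks (𝐀)_{i,i} = L_{i−1} for 0 ≤ i ≤ n−1, subdiagonal blocks (𝐀)_{i,i−1} = −R_{i−1} for 1 ≤ i ≤ n−1, and all other blocks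 zero. Then 𝐀_{M,M_p−1} is invertible and ‖𝐀_{M,M_p−1}^{−1}‖ ≤ (2eM/(ηT) + M_p) · (1 + max_{0≤j≤M−1} ‖L_j^{−1}‖), where ‖·‖ is the spectral norm and e is Euler's number. -/
/-- The all-at-once matrix `𝐀_{M,M_p-1}` of a single-step ODE discretization with `M` time
steps and `M_p - 1` padding rows: diagonal blocks `(𝐀)_{i,i} = L_{i-1}`, subdiagonal blocks
`(𝐀)_{i,i-1} = -R_{i-1}` (all other blocks zero), where `L_{-1} = I`, `L_j = I` and
`R_j = I` for `M ≤ j ≤ M + M_p - 2`. -/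
noncomputable def allAtOnce (d M Mp : ℕ) (L R : ℕ → Matrix (Fin d) (Fin d) ℂ) :
    Matrix (Fin (M + Mp) × Fin d) (Fin (M + Mp) × Fin d) ℂ :=
  blockMat fun i j =>
    if i.val = j.val then (if 1 ≤ i.val ∧ i.val ≤ M then L (i.val - 1) else 1)
    else if i.val = j.val + 1 then -(if j.val < M then R j.val else 1)
    else 0

open Finset in
/-- A discrete Grönwall step in `ℓ²`. -/
lemma sqrt_sum_sq_succ_le (u f : ℕ → ℝ) (hu : ∀ i, 0 ≤ u i) {q : ℝ} (hq : 0 ≤ q) (k : ℕ)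
    (h0 : u 0 ≤ f 0) (hs : ∀ i < k, u (i + 1) ≤ q * u i + f (i + 1)) :
    √(∑ i ∈ range (k + 1), u i ^ 2) ≤
      q * √(∑ i ∈ range k, u i ^ 2) + √(∑ i ∈ range (k + 1), f i ^ 2) := by
  let v : ℕ → ℝ := fun i => if i = 0 then 0 else q * u (i - 1)
  have hv : ∑ i ∈ range (k + 1), v i ^ 2 = q ^ 2 * ∑ i ∈ range k, u i ^ 2 := by
    rw [sum_range_succ', mul_sum]
    simp [v, mul_pow]
  have hle : ∀ i ∈ range (k + 1), u i ^ 2 ≤ (v i + f i) ^ 2 := by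
    intro i hi
    refine pow_le_pow_left₀ (hu i) ?_ 2
    rcases i with _ | i
    · simpa [v] using h0
    · simpa [v] using hs i (by simpa using hi)
  have hsq : √(∑ i ∈ range (k + 1), v i ^ 2) = q * √(∑ i ∈ range k, u i ^ 2) := by
    rw [hv, Real.sqrt_mul (sq_nonneg q), Real.sqrt_sq hq]
  rw [← hsq]
  have hcs := Real.sum_mul_le_sqrt_mul_sqrt (range (k + 1)) v f
  refine Real.sqrt_le_iff.mpr ⟨by positivity, (sum_le_sum hle).trans ?_⟩
  have hV := Real.sq_sqrt (sum_nonneg fun i (_ : i ∈ range (k + 1)) => sq_nonneg (v i))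
  have hF := Real.sq_sqrt (sum_nonneg fun i (_ : i ∈ range (k + 1)) => sq_nonneg (f i))
  have hexp : ∑ i ∈ range (k + 1), (v i + f i) ^ 2 =
      ∑ i ∈ range (k + 1), v i ^ 2 + 2 * ∑ i ∈ range (k + 1), v i * f i
        + ∑ i ∈ range (k + 1), f i ^ 2 := by
    rw [mul_sum, ← sum_add_distrib, ← sum_add_distrib]
    exact sum_congr rfl fun i _ => by ring
  rw [hexp]
  nlinarith

open Finset in
/-- Stability of a scalar recursion that contracts with rate `q < 1` for the first `M` steps and
is merely non-expansive afterwards. -/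
lemma sqrt_sum_sq_le_of_contraction (u f : ℕ → ℝ) (hu : ∀ i, 0 ≤ u i) {q : ℝ} (hq : 0 ≤ q)
    (hq1 : q < 1) (M m : ℕ) (h0 : u 0 ≤ f 0) (hs : ∀ i < M, u (i + 1) ≤ q * u i + f (i + 1))
    (hs' : ∀ i, M ≤ i → i < M + m → u (i + 1) ≤ u i + f (i + 1)) :
    √(∑ i ∈ range (M + m + 1), u i ^ 2) ≤
      (1 / (1 - q) + m) * √(∑ i ∈ range (M + m + 1), f i ^ 2) := by
  have hmono : ∀ (g : ℕ → ℝ) (k : ℕ),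
      √(∑ i ∈ range k, g i ^ 2) ≤ √(∑ i ∈ range (k + 1), g i ^ 2) := by
    intro g k
    apply Real.sqrt_le_sqrt
    rw [sum_range_succ]
    exact le_add_of_nonneg_right (sq_nonneg _)
  have hq' : 0 < 1 - q := by linarith
  induction m with
  | zero =>
    have h1 := sqrt_sum_sq_succ_le u f hu hq M h0 hs
    have h2 := mul_le_mul_of_nonneg_left (hmono u M) hq
    simp only [Nat.cast_zero, add_zero]
    rw [one_div_mul_eq_div, le_div_iff₀ hq']
    linarith
  | succ m ih =>
    have h1 := sqrt_sum_sq_succ_le u f hu zero_le_one (M + m + 1) h0 (by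
      intro i hi
      rw [one_mul]
      by_cases h : i < M
      · have := hs i h
        nlinarith [hu i]
      · exact hs' i (by omega) (by omega))
    have h2 := ih fun i h h' => hs' i h (by omega)
    have h3 := mul_le_mul_of_nonneg_left (hmono f (M + m + 1))
      (show 0 ≤ 1 / (1 - q) + (m : ℝ) by positivity)
    rw [← add_assoc]
    push_cast
    linarith

lemma blockMat_mulVec {n d : ℕ} (B : Fin n → Fin n → Matrix (Fin d) (Fin d) ℂ)
    (y : Fin n × Fin d → ℂ) (i : Fin n) :
    (fun a => (blockMat B).mulVec y (i, a)) = ∑ j, (B i j).mulVec fun b => y (j, b) := by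
  ext a
  simp [blockMat, Matrix.mulVec, dotProduct, Fintype.sum_prod_type, Finset.sum_apply]

lemma allAtOnce_mulVec_zero {d M Mp : ℕ} (L R : ℕ → Matrix (Fin d) (Fin d) ℂ)
    (y : Fin (M + Mp) × Fin d → ℂ) (h : 0 < M + Mp) :
    (fun a => (allAtOnce d M Mp L R).mulVec y (⟨0, h⟩, a)) = fun a => y (⟨0, h⟩, a) := by
  rw [allAtOnce, blockMat_mulVec, Finset.sum_eq_single ⟨0, h⟩]
  · simp
  · intro j _ hj
    have : (0 : ℕ) ≠ j.val := fun hc => hj (Fin.ext hc.symm)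
    simp [this]
  · simp

lemma allAtOnce_mulVec_succ {d M Mp : ℕ} (L R : ℕ → Matrix (Fin d) (Fin d) ℂ)
    (y : Fin (M + Mp) × Fin d → ℂ) (i : ℕ) (h : i + 1 < M + Mp) :
    (fun a => (allAtOnce d M Mp L R).mulVec y (⟨i + 1, h⟩, a)) =
      (if i < M then L i else 1).mulVec (fun a => y (⟨i + 1, h⟩, a)) -
        (if i < M then R i else 1).mulVec (fun a => y (⟨i, by omega⟩, a)) := by
  rw [allAtOnce, blockMat_mulVec,
    Finset.sum_eq_add ⟨i + 1, h⟩ ⟨i, Nat.lt_of_succ_lt h⟩ (by simp)]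
  · simp [Matrix.neg_mulVec, sub_eq_add_neg]
  · rintro j - ⟨hj, hj'⟩
    have h1 : i + 1 ≠ j.val := fun hc => hj (Fin.ext hc.symm)
    have h2 : i ≠ j.val := fun hc => hj' (Fin.ext hc.symm)
    simp [h1, h2]
  · simp
  · simp

lemma norm_toLp_mulVec_le {m : Type*} [Fintype m] [DecidableEq m] (A : Matrix m m ℂ)
    (x : m → ℂ) : ‖WithLp.toLp 2 (A.mulVec x)‖ ≤ specNorm A * ‖WithLp.toLp 2 x‖ := by
  simpa [specNorm] using (Matrix.toEuclideanCLM (𝕜 := ℂ) A).le_opNorm (WithLp.toLp 2 x)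

lemma norm_toLp_prod {n d : ℕ} (y : Fin n × Fin d → ℂ) :
    ‖WithLp.toLp 2 y‖ = √(∑ i ∈ Finset.range n,
      (if h : i < n then ‖WithLp.toLp 2 fun a => y (⟨i, h⟩, a)‖ else 0) ^ 2) := by
  rw [EuclideanSpace.norm_eq, Finset.sum_range]
  simp [Fintype.sum_prod_type, EuclideanSpace.norm_sq_eq]

/-- A matrix that is bounded below by `1 / C` is invertible with inverse bounded by `C`. -/
lemma isUnit_and_specNorm_inv_le {m : Type*} [Fintype m] [DecidableEq m] (A : Matrix m m ℂ)
    {C : ℝ} (hC : 0 ≤ C)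
    (h : ∀ y : m → ℂ, ‖WithLp.toLp 2 y‖ ≤ C * ‖WithLp.toLp 2 (A.mulVec y)‖) :
    IsUnit A ∧ specNorm A⁻¹ ≤ C := by
  have hu : IsUnit A := by
    rw [← Matrix.mulVec_injective_iff_isUnit]
    intro x y hxy
    have := h (x - y)
    rw [Matrix.mulVec_sub, sub_eq_zero.mpr hxy, WithLp.toLp_zero, norm_zero, mul_zero] at this
    simpa [sub_eq_zero] using this
  refine ⟨hu, ContinuousLinearMap.opNorm_le_bound _ hC fun x => ?_⟩
  have := h (A⁻¹.mulVec x.ofLp)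
  rw [Matrix.mulVec_mulVec, Matrix.mul_nonsing_inv _ ((Matrix.isUnit_iff_isUnit_det _).mp hu),
    Matrix.one_mulVec] at this
  exact this

lemma one_div_one_sub_exp_neg_le {x : ℝ} (hx : 0 < x) :
    1 / (1 - Real.exp (-x)) ≤ 1 + 1 / x := by
  have h1 : 0 < 1 - Real.exp (-x) := by simpa using hx
  have h2 := Real.add_one_le_exp x
  have h3 : Real.exp (-x) * Real.exp x = 1 := by rw [← Real.exp_add]; simp
  have h4 := Real.exp_pos (-x)
  rw [div_le_iff₀ h1, show (1 + 1 / x) * (1 - Real.exp (-x)) =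
    (x + 1) * (1 - Real.exp (-x)) / x by field_simp, le_div_iff₀ hx]
  nlinarith

/-- A two-term linear relation `b = L z - R w` with `L` invertible bounds `z`. -/
lemma norm_le_of_eq_mulVec_sub {m : Type*} [Fintype m] [DecidableEq m] {L R : Matrix m m ℂ}
    (hL : IsUnit L) {b z w : m → ℂ} (h : b = L.mulVec z - R.mulVec w) :
    ‖WithLp.toLp 2 z‖ ≤
      specNorm (L⁻¹ * R) * ‖WithLp.toLp 2 w‖ + specNorm L⁻¹ * ‖WithLp.toLp 2 b‖ := by
  have hz : z = (L⁻¹ * R).mulVec w + L⁻¹.mulVec b := by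
    rw [h, Matrix.mulVec_sub, Matrix.mulVec_mulVec, Matrix.mulVec_mulVec,
      Matrix.nonsing_inv_mul _ ((Matrix.isUnit_iff_isUnit_det _).mp hL), Matrix.one_mulVec]
    abel
  calc ‖WithLp.toLp 2 z‖
      = ‖WithLp.toLp 2 ((L⁻¹ * R).mulVec w) + WithLp.toLp 2 (L⁻¹.mulVec b)‖ := by
        rw [← WithLp.toLp_add, ← hz]
    _ ≤ _ := (norm_add_le _ _).trans
        (add_le_add (norm_toLp_mulVec_le _ _) (norm_toLp_mulVec_le _ _))

lemma norm_le_allAtOnce_mulVec {d M Mp : ℕ} (hMp : 1 ≤ Mp)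
    {L R : ℕ → Matrix (Fin d) (Fin d) ℂ} {q c : ℝ} (hq : 0 ≤ q) (hq1 : q < 1) (hc : 1 ≤ c)
    (hL : ∀ j < M, IsUnit (L j)) (hLR : ∀ j < M, specNorm ((L j)⁻¹ * R j) ≤ q)
    (hLc : ∀ j < M, specNorm (L j)⁻¹ ≤ c) (y : Fin (M + Mp) × Fin d → ℂ) :
    ‖WithLp.toLp 2 y‖ ≤ (1 / (1 - q) + (Mp - 1 : ℕ)) * c *
      ‖WithLp.toLp 2 ((allAtOnce d M Mp L R).mulVec y)‖ := by
  set z := (allAtOnce d M Mp L R).mulVec y with hz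
  let u : (Fin (M + Mp) × Fin d → ℂ) → ℕ → ℝ := fun x i =>
    if h : i < M + Mp then ‖WithLp.toLp 2 fun a => x (⟨i, h⟩, a)‖ else 0
  have hu : ∀ x i, 0 ≤ u x i := by
    intro x i
    simp only [u]
    split_ifs <;> simp
  have key := sqrt_sum_sq_le_of_contraction (u y) (fun i => c * u z i) (hu y) hq hq1 M (Mp - 1)
    (by
      have h : 0 < M + Mp := by omega
      have h0 : u z 0 = u y 0 := by
        simp only [u, h, dif_pos, hz, allAtOnce_mulVec_zero]
      rw [h0]
      exact le_mul_of_one_le_left (hu y 0) hc)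
    (by
      intro i hi
      have h : i < M + Mp := by omega
      have h' : i + 1 < M + Mp := by omega
      have hrec := allAtOnce_mulVec_succ L R y i h'
      rw [if_pos hi, if_pos hi] at hrec
      have := norm_le_of_eq_mulVec_sub (hL i hi) hrec
      simp only [u, h, h', dif_pos]
      refine this.trans ?_
      gcongr
      exacts [hLR i hi, hLc i hi])
    (by
      intro i hi hi'
      have h : i < M + Mp := by omega
      have h' : i + 1 < M + Mp := by omega
      have hrec := allAtOnce_mulVec_succ L R y i h'
      rw [if_neg (by omega), if_neg (by omega), Matrix.one_mulVec, Matrix.one_mulVec] at hrec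
      have hy : (WithLp.toLp 2 fun a => y (⟨i + 1, h'⟩, a)) =
          (WithLp.toLp 2 fun a => y (⟨i, h⟩, a)) + WithLp.toLp 2 fun a => z (⟨i + 1, h'⟩, a) := by
        rw [hz, hrec, ← WithLp.toLp_add, add_sub_cancel]
      simp only [u, h, h', dif_pos]
      rw [hy]
      exact (norm_add_le _ _).trans
        (add_le_add le_rfl (le_mul_of_one_le_left (norm_nonneg _) hc)))
  rw [show M + (Mp - 1) + 1 = M + Mp by omega] at key
  simp only [mul_pow, ← Finset.mul_sum] at key
  rw [Real.sqrt_mul (sq_nonneg c), Real.sqrt_sq (by linarith)] at key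
  rw [norm_toLp_prod y, norm_toLp_prod z, mul_assoc]
  exact key

/-- **Spectral norm bound for the inverse of the all-at-once matrix.**
If `η h ≤ 1` with `h = T/M`, each `L_j` (for `j < M`) is invertible, and each one-step
propagator satisfies `‖L_j⁻¹ R_j‖ ≤ e^{-ηh/2}`, then `𝐀_{M,M_p-1}` is invertible and
`‖𝐀_{M,M_p-1}⁻¹‖ ≤ (2eM/(ηT) + M_p)(1 + max_j ‖L_j⁻¹‖)`. -/
theorem allAtOnce_inv_specNorm_le (d M Mp : ℕ) (hd : 1 ≤ d) (hM : 1 ≤ M) (hMp : 1 ≤ Mp)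
    (T η h : ℝ) (hT : 0 < T) (hη : 0 < η) (hh : h = T / M) (hηh : η * h ≤ 1)
    (L R : ℕ → Matrix (Fin d) (Fin d) ℂ)
    (hL : ∀ j < M, IsUnit (L j))
    (hLR : ∀ j < M, specNorm ((L j)⁻¹ * R j) ≤ Real.exp (-(η * h) / 2)) :
    IsUnit (allAtOnce d M Mp L R) ∧
      specNorm ((allAtOnce d M Mp L R)⁻¹) ≤
        (2 * Real.exp 1 * M / (η * T) + Mp) *
          (1 + ((Finset.range M).sup' (Finset.nonempty_range_iff.mpr (by omega))
            fun j => specNorm ((L j)⁻¹))) := by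
  set S := (Finset.range M).sup' (Finset.nonempty_range_iff.mpr (by omega))
    fun j => specNorm ((L j)⁻¹) with hS
  have hLS : ∀ j < M, specNorm (L j)⁻¹ ≤ S := fun j hj =>
    Finset.le_sup' (fun j => specNorm ((L j)⁻¹)) (Finset.mem_range.mpr hj)
  have hS0 : 0 ≤ S := (norm_nonneg _).trans (hLS 0 hM)
  have hM0 : (0 : ℝ) < M := by exact_mod_cast hM
  have hx : 0 < η * h / 2 := by rw [hh]; positivity
  have hq1 : Real.exp (-(η * h) / 2) < 1 := by
    rw [Real.exp_lt_one_iff]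
    linarith
  have hq := one_div_one_sub_exp_neg_le hx
  rw [← neg_div] at hq
  have hC : 1 / (1 - Real.exp (-(η * h) / 2)) + (Mp - 1 : ℕ) ≤
      2 * Real.exp 1 * M / (η * T) + Mp := by
    have h1 : 1 / (η * h / 2) = 2 * 1 * M / (η * T) := by
      rw [hh]
      field_simp
    have h2 : 2 * 1 * M / (η * T) ≤ 2 * Real.exp 1 * M / (η * T) := by
      gcongr
      exact Real.one_le_exp zero_le_one
    push_cast [Nat.cast_sub hMp]
    linarith
  refine isUnit_and_specNorm_inv_le _ (by positivity) fun y => ?_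
  refine (norm_le_allAtOnce_mulVec hMp (Real.exp_nonneg _) hq1 (c := 1 + S) (by linarith) hL hLR
    (fun j hj => (hLS j hj).trans (by linarith)) y).trans ?_
  gcongr
end

section
/- Let η > 0, h > 0, ε₁ ≥ 0, ε₂ ≥ 0, β ≥ 0, and let P_0, …, P_{M−1}, Q_0, …, Q_{M−1} ∈ ℂ^{d×d} satisfy ‖P_j‖ ≤ e^{−ηh/2}, ‖Q_j‖ ≤ e^{−ηh/2}, and ‖P_j − Q_j‖ ≤ ε₁ for all j; let c_0, …, c_{M−1}, w_0, …, w_{M−1} ∈ ℂ^d satisfy ‖c_j − w_j‖ ≤ ε₂ and ‖w_j‖ ≤ h·β for all j. Define sequences x_0 = y_0 ∈ ℂ^d and x_{k+1} = P_k x_k + c_k, y_{k+1} = Q_k y_k + w_k for 0 ≤ k ≤ M−1. Then for every 1 ≤ k ≤ M, ‖x_k − y_k‖ ≤ k·ε₁·e^{−η(k−1)h/2}·‖x_0‖ + ε₁·h·β/(1 − e^{−ηh/2})² + ε₂/(1 − e^{−ηh/2}). -/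
/-- The action of a square complex matrix on Euclidean space, as a vector. -/
noncomputable def matVec {m : Type*} [Fintype m] [DecidableEq m]
    (A : Matrix m m ℂ) (v : EuclideanSpace ℂ m) : EuclideanSpace ℂ m :=
  Matrix.toEuclideanCLM (𝕜 := ℂ) A v

/-- A perturbed linear recurrence contracting at rate `r` stays within the geometric-series
bound of its inhomogeneity. -/
theorem norm_affine_recurrence_le {E : Type*} [NormedAddCommGroup E] [NormedSpace ℂ E]
    {M : ℕ} {r b : ℝ} (hr1 : r < 1) (hb : 0 ≤ b)
    {Q : ℕ → E →L[ℂ] E} {w y : ℕ → E}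
    (hQ : ∀ j < M, ‖Q j‖ ≤ r) (hw : ∀ j < M, ‖w j‖ ≤ b)
    (hy : ∀ k < M, y (k + 1) = Q k (y k) + w k) :
    ∀ k ≤ M, ‖y k‖ ≤ r ^ k * ‖y 0‖ + b / (1 - r) := by
  have hr : 0 < 1 - r := sub_pos.2 hr1
  intro k
  induction k with
  | zero =>
    intro _
    have : 0 ≤ b / (1 - r) := by positivity
    simpa using this
  | succ k ih =>
    intro hk
    calc ‖y (k + 1)‖ = ‖Q k (y k) + w k‖ := by rw [hy k hk]
      _ ≤ ‖Q k (y k)‖ + ‖w k‖ := norm_add_le _ _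
      _ ≤ r * (r ^ k * ‖y 0‖ + b / (1 - r)) + b :=
        add_le_add ((Q k).le_of_opNorm_le_of_le (hQ k hk) (ih (Nat.le_of_succ_le hk))) (hw k hk)
      _ = r ^ (k + 1) * ‖y 0‖ + b / (1 - r) := by
        field_simp
        ring

/-- Error between two affine recurrences contracting at rate `r` and started at the same point. -/
theorem norm_sub_affine_recurrence_le {E : Type*} [NormedAddCommGroup E] [NormedSpace ℂ E]
    {M : ℕ} {r b ε₁ ε₂ : ℝ} (hr1 : r < 1) (hb : 0 ≤ b)
    (hε₁ : 0 ≤ ε₁) (hε₂ : 0 ≤ ε₂)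
    {P Q : ℕ → E →L[ℂ] E} {c w x y : ℕ → E}
    (hP : ∀ j < M, ‖P j‖ ≤ r) (hQ : ∀ j < M, ‖Q j‖ ≤ r) (hPQ : ∀ j < M, ‖P j - Q j‖ ≤ ε₁)
    (hcw : ∀ j < M, ‖c j - w j‖ ≤ ε₂) (hw : ∀ j < M, ‖w j‖ ≤ b)
    (hxy0 : x 0 = y 0)
    (hx : ∀ k < M, x (k + 1) = P k (x k) + c k)
    (hy : ∀ k < M, y (k + 1) = Q k (y k) + w k) :
    ∀ k ≤ M, ‖x k - y k‖ ≤
      k * ε₁ * r ^ (k - 1) * ‖x 0‖ + ε₁ * b / (1 - r) ^ 2 + ε₂ / (1 - r) := by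
  have hr : 0 < 1 - r := sub_pos.2 hr1
  intro k
  induction k with
  | zero =>
    intro _
    have : 0 ≤ ε₁ * b / (1 - r) ^ 2 + ε₂ / (1 - r) := by positivity
    simpa [hxy0] using this
  | succ k ih =>
    intro hk
    have hk' : k ≤ M := Nat.le_of_succ_le hk
    have hyk := norm_affine_recurrence_le hr1 hb hQ hw hy k hk'
    rw [← hxy0] at hyk
    have hsplit : x (k + 1) - y (k + 1) =
        P k (x k - y k) + (P k - Q k) (y k) + (c k - w k) := by
      rw [hx k hk, hy k hk, map_sub, sub_apply]
      abel
    have hpow : r * (k * r ^ (k - 1)) = k * r ^ k := by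
      cases k with
      | zero => simp
      | succ n => rw [Nat.add_sub_cancel]; ring
    calc ‖x (k + 1) - y (k + 1)‖
        ≤ ‖P k (x k - y k)‖ + ‖(P k - Q k) (y k)‖ + ‖c k - w k‖ := by
          rw [hsplit]
          exact norm_add₃_le
      _ ≤ r * (k * ε₁ * r ^ (k - 1) * ‖x 0‖ + ε₁ * b / (1 - r) ^ 2 + ε₂ / (1 - r)) +
            ε₁ * (r ^ k * ‖x 0‖ + b / (1 - r)) + ε₂ :=
          add_le_add (add_le_add ((P k).le_of_opNorm_le_of_le (hP k hk) (ih hk'))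
            ((P k - Q k).le_of_opNorm_le_of_le (hPQ k hk) hyk)) (hcw k hk)
      _ = r * (k * r ^ (k - 1)) * ε₁ * ‖x 0‖ + ε₁ * r ^ k * ‖x 0‖ +
            (r * (ε₁ * b / (1 - r) ^ 2) + ε₁ * (b / (1 - r))) +
            (r * (ε₂ / (1 - r)) + ε₂) := by ring
      _ = k * r ^ k * ε₁ * ‖x 0‖ + ε₁ * r ^ k * ‖x 0‖ +
            ε₁ * b / (1 - r) ^ 2 + ε₂ / (1 - r) := by
          have h₁ : r * (ε₁ * b / (1 - r) ^ 2) + ε₁ * (b / (1 - r)) =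
              ε₁ * b / (1 - r) ^ 2 := by
            field_simp
            ring
          have h₂ : r * (ε₂ / (1 - r)) + ε₂ = ε₂ / (1 - r) := by
            field_simp
            ring
          rw [hpow, h₁, h₂]
      _ = _ := by
          rw [Nat.add_sub_cancel]
          push_cast
          ring

/-- **Stepwise error bound for perturbed one-step recurrences.**
If `x_{k+1} = P_k x_k + c_k` and `y_{k+1} = Q_k y_k + w_k` with `x_0 = y_0`, where the
one-step operators are contractions at rate `e^{-ηh/2}`, `‖P_j - Q_j‖ ≤ ε₁`,
`‖c_j - w_j‖ ≤ ε₂` and `‖w_j‖ ≤ hβ`, then for `1 ≤ k ≤ M`,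
`‖x_k - y_k‖ ≤ k ε₁ e^{-η(k-1)h/2} ‖x_0‖ + ε₁ h β/(1-e^{-ηh/2})² + ε₂/(1-e^{-ηh/2})`. -/
theorem stepwise_error_bound (d M : ℕ) (η h ε₁ ε₂ β : ℝ)
    (hη : 0 < η) (hh : 0 < h) (hε₁ : 0 ≤ ε₁) (hε₂ : 0 ≤ ε₂) (hβ : 0 ≤ β)
    (P Q : ℕ → Matrix (Fin d) (Fin d) ℂ)
    (hP : ∀ j < M, specNorm (P j) ≤ Real.exp (-(η * h) / 2))
    (hQ : ∀ j < M, specNorm (Q j) ≤ Real.exp (-(η * h) / 2))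
    (hPQ : ∀ j < M, specNorm (P j - Q j) ≤ ε₁)
    (c w : ℕ → EuclideanSpace ℂ (Fin d))
    (hcw : ∀ j < M, ‖c j - w j‖ ≤ ε₂)
    (hw : ∀ j < M, ‖w j‖ ≤ h * β)
    (x y : ℕ → EuclideanSpace ℂ (Fin d))
    (hxy0 : x 0 = y 0)
    (hx : ∀ k < M, x (k + 1) = matVec (P k) (x k) + c k)
    (hy : ∀ k < M, y (k + 1) = matVec (Q k) (y k) + w k) :
    ∀ k, 1 ≤ k → k ≤ M →
      ‖x k - y k‖ ≤
        k * ε₁ * Real.exp (-(η * ((k : ℝ) - 1) * h) / 2) * ‖x 0‖ +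
          ε₁ * h * β / (1 - Real.exp (-(η * h) / 2)) ^ 2 +
          ε₂ / (1 - Real.exp (-(η * h) / 2)) := by
  intro k hk1 hkM
  have hr1 : Real.exp (-(η * h) / 2) < 1 := by
    rw [Real.exp_lt_one_iff]
    have := mul_pos hη hh
    linarith
  have key := norm_sub_affine_recurrence_le hr1 (mul_nonneg hh.le hβ)
    hε₁ hε₂ (P := fun j => Matrix.toEuclideanCLM (𝕜 := ℂ) (P j))
    (Q := fun j => Matrix.toEuclideanCLM (𝕜 := ℂ) (Q j)) hP hQ
    (fun j hj => by simpa [specNorm] using hPQ j hj) hcw hw hxy0 hx hy k hkM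
  have hexp : Real.exp (-(η * h) / 2) ^ (k - 1) =
      Real.exp (-(η * ((k : ℝ) - 1) * h) / 2) := by
    rw [← Real.exp_nat_mul, Nat.cast_sub hk1]
    congr 1
    push_cast
    ring
  rwa [hexp, ← mul_assoc ε₁ h β] at key
end

section
/- Let N ≥ 1, h > 0, T > 0 with M = T/h a positive integer, and let a > 0 with T ≥ 1/a. Let A : ℝ → ℂ^{N×N} be continuous on [0,T] with ‖A(s)‖ ≤ a for all s ∈ [0,T], and let u : ℝ → ℂ^N be differentiable on [0,T] with u'(s) = A(s)·u(s) for all s ∈ [0,T]. Then √( Σ_{j=0}^{M} ‖u(jh)‖² ) ≥ ‖u(0)‖ / (2·√(h·a)). -/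
/-- Backward Grönwall estimate: if `‖u'‖ ≤ a ‖u‖` on `[0, T]`, then `‖u 0‖ ≤ ‖u t‖ exp (a t)`. -/
theorem norm_zero_le_norm_mul_exp {E : Type*} [NormedAddCommGroup E] [NormedSpace ℝ E]
    {u u' : ℝ → E} {a T t : ℝ} (ht : t ∈ Set.Icc 0 T)
    (hu : ∀ s ∈ Set.Icc (0 : ℝ) T, HasDerivWithinAt u (u' s) (Set.Icc 0 T) s)
    (hbound : ∀ s ∈ Set.Icc (0 : ℝ) T, ‖u' s‖ ≤ a * ‖u s‖) :
    ‖u 0‖ ≤ ‖u t‖ * Real.exp (a * t) := by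
  have hmaps : Set.MapsTo (fun s => t - s) (Set.Icc 0 t) (Set.Icc 0 T) := by
    intro s hs
    exact ⟨by linarith [hs.2], by linarith [hs.1, ht.2]⟩
  have hcomp : ∀ s ∈ Set.Icc 0 t,
      HasDerivWithinAt (fun s => u (t - s)) (-u' (t - s)) (Set.Icc 0 t) s := by
    intro s hs
    have hsub : HasDerivWithinAt (fun s : ℝ => t - s) (-1) (Set.Icc 0 t) s :=
      (hasDerivWithinAt_id s _).const_sub t
    simpa [Function.comp_def] using (hu (t - s) (hmaps hs)).scomp s hsub hmaps
  have hgron := norm_le_gronwallBound_of_norm_deriv_right_le (f := fun s => u (t - s))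
    (f' := fun s => -u' (t - s)) (δ := ‖u t‖) (K := a) (ε := 0) (a := 0) (b := t)
    (fun s hs => (hcomp s hs).continuousWithinAt)
    (fun s hs => ((hcomp s (Set.Ico_subset_Icc_self hs)).mono
      (Set.Icc_subset_Icc_left hs.1)).mono_of_mem_nhdsWithin (Icc_mem_nhdsGE hs.2))
    (by simp)
    (fun s hs => by simpa using hbound _ (hmaps (Set.Ico_subset_Icc_self hs)))
    t ⟨ht.1, le_rfl⟩
  simpa [gronwallBound_ε0] using hgron

/-- If `M x ≥ 1`, the geometric sum of `exp (-2 x j)` over `j ≤ M` is at least `1 / (4 x)`. -/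
theorem one_div_le_sum_exp_neg {x : ℝ} (hx : 0 < x) {M : ℕ} (hM : 1 ≤ M * x) :
    1 / (4 * x) ≤ ∑ j ∈ Finset.range (M + 1), Real.exp (-(2 * x)) ^ j := by
  set r := Real.exp (-(2 * x)) with hr
  have hr1 : r < 1 := by rw [hr, Real.exp_lt_one_iff]; linarith
  have hrx : 1 - r ≤ 2 * x := by linarith [Real.add_one_le_exp (-(2 * x))]
  have hpow : r ^ (M + 1) ≤ 1 / 2 := by
    rw [hr, ← Real.exp_nat_mul]
    calc Real.exp (((M + 1 : ℕ) : ℝ) * -(2 * x)) ≤ Real.exp (-1) := by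
          apply Real.exp_le_exp.mpr
          push_cast
          nlinarith
      _ ≤ 1 / 2 := by
          rw [Real.exp_neg, inv_eq_one_div]
          exact one_div_le_one_div_of_le two_pos (by linarith [Real.add_one_le_exp 1])
  have hgeom := mul_neg_geom_sum r (M + 1)
  rw [div_le_iff₀ (by positivity)]
  have hnonneg : 0 ≤ ∑ j ∈ Finset.range (M + 1), r ^ j :=
    Finset.sum_nonneg fun j _ => pow_nonneg (Real.exp_pos _).le j
  nlinarith [mul_le_mul_of_nonneg_right hrx hnonneg]

/-- **Lower bound on the norm of the history vector (homogeneous case).**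
If `‖A(s)‖ ≤ a` on `[0, T]`, `u' = A u` on `[0, T]`, `M h = T` and `T ≥ 1/a`, then
`√(∑_{j=0}^M ‖u(jh)‖²) ≥ ‖u(0)‖ / (2 √(h a))`. -/
theorem homogeneous_history_norm_lower_bound (N : ℕ) (hN : 1 ≤ N)
    (h T : ℝ) (hh : 0 < h) (hT : 0 < T)
    (M : ℕ) (hM : 1 ≤ M) (hMh : (M : ℝ) * h = T)
    (a : ℝ) (ha : 0 < a) (hTa : 1 / a ≤ T)
    (A : ℝ → Matrix (Fin N) (Fin N) ℂ)
    (hAcont : ContinuousOn A (Set.Icc 0 T))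
    (hAnorm : ∀ s ∈ Set.Icc (0 : ℝ) T, specNorm (A s) ≤ a)
    (u : ℝ → EuclideanSpace ℂ (Fin N))
    (hu : ∀ s ∈ Set.Icc (0 : ℝ) T,
      HasDerivWithinAt u (matVec (A s) (u s)) (Set.Icc 0 T) s) :
    ‖u 0‖ / (2 * Real.sqrt (h * a)) ≤
      Real.sqrt (∑ j ∈ Finset.range (M + 1), ‖u (j * h)‖ ^ 2) := by
  have hdecay : ∀ t ∈ Set.Icc (0 : ℝ) T, ‖u 0‖ ≤ ‖u t‖ * Real.exp (a * t) := fun t ht =>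
    norm_zero_le_norm_mul_exp ht hu fun s hs =>
      ((Matrix.toEuclideanCLM (𝕜 := ℂ) (A s)).le_opNorm (u s)).trans
        (mul_le_mul_of_nonneg_right (hAnorm s hs) (norm_nonneg _))
  have hterm : ∀ j ∈ Finset.range (M + 1),
      ‖u 0‖ ^ 2 * Real.exp (-(2 * (h * a))) ^ j ≤ ‖u (j * h)‖ ^ 2 := by
    intro j hj
    have hjM : (j : ℝ) ≤ M := by exact_mod_cast Finset.mem_range_succ_iff.mp hj
    have hbound := hdecay (j * h) ⟨by positivity, hMh ▸ by gcongr⟩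
    have hexp : Real.exp (-(2 * (h * a))) ^ j = (Real.exp (a * (j * h)) ^ 2)⁻¹ := by
      rw [← Real.exp_nat_mul, ← Real.exp_nat_mul, ← Real.exp_neg]
      congr 1
      push_cast
      ring
    rw [hexp, ← div_eq_mul_inv, div_le_iff₀ (by positivity), ← mul_pow]
    gcongr
  have hsum : ‖u 0‖ ^ 2 * (1 / (4 * (h * a))) ≤ ∑ j ∈ Finset.range (M + 1), ‖u (j * h)‖ ^ 2 := by
    refine le_trans ?_ (Finset.sum_le_sum hterm)
    rw [← Finset.mul_sum]
    gcongr
    apply one_div_le_sum_exp_neg (mul_pos hh ha)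
    rw [← mul_assoc, hMh]
    exact (div_le_iff₀ ha).mp hTa
  apply Real.le_sqrt_of_sq_le
  rw [div_pow, mul_pow, Real.sq_sqrt (mul_pos hh ha).le]
  exact le_of_eq_of_le (by ring) hsum
end

section
/- Let M > 0, η > 0, and T > 0 be real numbers and define f : (0,∞) → ℝ by f(x) = √((M + x)/x) · ( M/(ηT) + x ). Then f attains its global minimum on (0,∞) at the point x* = 2M / ( ηT·(1 + √(1 + 8/(ηT))) ); that is, f(x*) ≤ f(x) for all x > 0. -/
/-- A positive root `y` of the critical-point equation `2y² + My = Mc` minimizes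
`(M + x)/x · (c + x)²` on `(0, ∞)`. -/
theorem div_mul_sq_le_of_critical {M c x y : ℝ} (hM : 0 < M) (hx : 0 < x) (hy : 0 < y)
    (hc : 2 * y ^ 2 + M * y = M * c) :
    (M + y) / y * (c + y) ^ 2 ≤ (M + x) / x * (c + x) ^ 2 := by
  obtain rfl : c = (2 * y ^ 2 + M * y) / M := by
    field_simp
    linarith
  have key : (M + x) / x * ((2 * y ^ 2 + M * y) / M + x) ^ 2
      - (M + y) / y * ((2 * y ^ 2 + M * y) / M + y) ^ 2
      = (x - y) ^ 2 * (x + (2 * y + M) ^ 2 / M) / x := by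
    field_simp
    ring
  have : 0 ≤ (x - y) ^ 2 * (x + (2 * y + M) ^ 2 / M) / x := by positivity
  linarith

/-- **Optimal number of padding rows.**
The function `f(x) = √((M + x)/x) (M/(ηT) + x)` attains its global minimum on `(0, ∞)` at
`x* = 2M/(ηT (1 + √(1 + 8/(ηT))))`. -/
theorem padding_optimal (M η T : ℝ) (hM : 0 < M) (hη : 0 < η) (hT : 0 < T)
    (f : ℝ → ℝ) (hf : ∀ x, f x = Real.sqrt ((M + x) / x) * (M / (η * T) + x)) :
    ∀ x, 0 < x →
      f (2 * M / (η * T * (1 + Real.sqrt (1 + 8 / (η * T))))) ≤ f x := by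
  intro x hx
  have hs : Real.sqrt (1 + 8 / (η * T)) ^ 2 = 1 + 8 / (η * T) :=
    Real.sq_sqrt (by positivity)
  have hs0 : 0 ≤ Real.sqrt (1 + 8 / (η * T)) := Real.sqrt_nonneg _
  generalize Real.sqrt (1 + 8 / (η * T)) = s at hs hs0 ⊢
  have hy : 0 < 2 * M / (η * T * (1 + s)) := by positivity
  have hc : 2 * (2 * M / (η * T * (1 + s))) ^ 2 + M * (2 * M / (η * T * (1 + s)))
      = M * (M / (η * T)) := by
    have h : η * T * s ^ 2 = η * T + 8 := by
      rw [hs]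
      field_simp
    field_simp
    linear_combination -h
  generalize 2 * M / (η * T * (1 + s)) = y at hy hc ⊢
  have hc0 : 0 < M / (η * T) := by positivity
  rw [hf, hf]
  refine abs_le_of_sq_le_sq' ?_ (by positivity) |>.2
  rw [mul_pow, mul_pow, Real.sq_sqrt (by positivity), Real.sq_sqrt (by positivity)]
  exact div_mul_sq_le_of_critical hM hx hy hc
end
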